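/- arXiv:1109.1487 — 2 statements merged into one kernel-verified Lean document; each statement's English description precedes it below -/
import Mathlib

section
/- Let G1 be a finite simple graph on n1 vertices realizing a ((k1,n1)) qQSS* access structure and let G2 be a finite simple graph on n2 vertices realizing a ((k2,n2)) qQSS* access structure. Then the lexicographic product G1 * G2, which has n = n1·n2 vertices, realizes a ((k,n)) qQSS* access structure with k = n1·n2 − (n1−k1+1)(n2−k2+1) + 1. -/
open Finset

/-- The odd neighborhood of a set `D` of vertices: the set of vertices having an odd
number of neighbors in `D`. -/
def oddNbhd {V : Type*} (G : SimpleGraph V) [Fintype V] [DecidableEq V]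
    [DecidableRel G.Adj] (D : Finset V) : Finset V :=
  Finset.univ.filter fun v => Odd ((G.neighborFinset v) ∩ D).card

/-- `B` is accessing: some `D ⊆ B` of odd cardinality has `Odd(D) ⊆ B`. -/
def accessing {V : Type*} (G : SimpleGraph V) [Fintype V] [DecidableEq V]
    [DecidableRel G.Adj] (B : Finset V) : Prop :=
  ∃ D ⊆ B, Odd D.card ∧ oddNbhd G D ⊆ B

/-- `B` is strongly accessing: it is accessing and moreover some `C ⊆ B` has
`V \ B ⊆ Odd(C)`. -/
def stronglyAccessing {V : Type*} (G : SimpleGraph V) [Fintype V] [DecidableEq V]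
    [DecidableRel G.Adj] (B : Finset V) : Prop :=
  accessing G B ∧ ∃ C ⊆ B, Bᶜ ⊆ oddNbhd G C

/-- `G` realizes a `((k,n))` qQSS* access structure (with `n` the number of vertices):
every set of `k` players is strongly accessing. -/
def realizesQQSS {V : Type*} (G : SimpleGraph V) [Fintype V] [DecidableEq V]
    [DecidableRel G.Adj] (k : ℕ) : Prop :=
  ∀ B : Finset V, B.card = k → stronglyAccessing G B

/-- The lexicographic product of two simple graphs: `(u1,u2)` and `(v1,v2)` are adjacent
iff `u1 ~ v1` in `G1`, or `u1 = v1` and `u2 ~ v2` in `G2`. -/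
def lexProd {V1 V2 : Type*} (G1 : SimpleGraph V1) (G2 : SimpleGraph V2) :
    SimpleGraph (V1 × V2) where
  Adj a b := G1.Adj a.1 b.1 ∨ (a.1 = b.1 ∧ G2.Adj a.2 b.2)
  symm := by
    constructor
    rintro a b (h | ⟨h1, h2⟩)
    · exact Or.inl h.symm
    · exact Or.inr ⟨h1.symm, h2.symm⟩
  loopless := by
    constructor
    rintro a (h | ⟨_, h2⟩)
    · exact G1.loopless.irrefl a.1 h
    · exact G2.loopless.irrefl a.2 h2

instance {V1 V2 : Type*} [DecidableEq V1] (G1 : SimpleGraph V1) (G2 : SimpleGraph V2)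
    [DecidableRel G1.Adj] [DecidableRel G2.Adj] :
    DecidableRel (lexProd G1 G2).Adj := fun a b =>
  inferInstanceAs (Decidable (G1.Adj a.1 b.1 ∨ (a.1 = b.1 ∧ G2.Adj a.2 b.2)))


theorem sa_mono {V : Type*} (G : SimpleGraph V) [Fintype V] [DecidableEq V]
    [DecidableRel G.Adj] {A B : Finset V} (hAB : A ⊆ B) (h : stronglyAccessing G A) :
    stronglyAccessing G B := by
  obtain ⟨⟨D, hD, ho, hD2⟩, C, hC, hC2⟩ := h
  exact ⟨⟨D, hD.trans hAB, ho, hD2.trans hAB⟩, C, hC.trans hAB,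
    (Finset.compl_subset_compl.mpr hAB).trans hC2⟩

theorem sa_of_le {V : Type*} (G : SimpleGraph V) [Fintype V] [DecidableEq V]
    [DecidableRel G.Adj] {k : ℕ} (h : realizesQQSS G k) {B : Finset V} (hB : k ≤ B.card) :
    stronglyAccessing G B := by
  obtain ⟨A, hA, hc⟩ := Finset.exists_subset_card_eq hB
  exact sa_mono G hA (h A hc)

theorem odd_card_symmDiff {V : Type*} [DecidableEq V] (A B : Finset V) :
    Odd (symmDiff A B).card ↔ ¬ (Odd A.card ↔ Odd B.card) := by
  have e : (symmDiff A B).card = (A \ B).card + (B \ A).card := by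
    rw [symmDiff_def, Finset.sup_eq_union]
    exact Finset.card_union_of_disjoint disjoint_sdiff_sdiff
  have e1 := Finset.card_sdiff_add_card_inter A B
  have e2 := Finset.card_sdiff_add_card_inter B A
  rw [Finset.inter_comm B A] at e2
  rw [e, ← e1, ← e2]
  simp only [Nat.odd_iff]
  omega

theorem sa_choose {V : Type*} (G : SimpleGraph V) [Fintype V] [DecidableEq V]
    [DecidableRel G.Adj] {B : Finset V} (h : stronglyAccessing G B) (p q : Prop) :
    ∃ X ⊆ B, (Odd X.card ↔ p) ∧ ∀ w ∉ B, (Odd (G.neighborFinset w ∩ X).card ↔ q) := by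
  obtain ⟨⟨D, hD, ho, hD2⟩, C, hC, hC2⟩ := h
  have hD3 : ∀ w ∉ B, ¬ Odd (G.neighborFinset w ∩ D).card := by
    intro w hw hh
    exact hw (hD2 (by simpa [oddNbhd] using hh))
  have hC3 : ∀ w ∉ B, Odd (G.neighborFinset w ∩ C).card := by
    intro w hw
    simpa [oddNbhd] using hC2 (Finset.mem_compl.mpr hw)
  have hDC : symmDiff C D ⊆ B := by
    intro x hx
    rw [Finset.mem_symmDiff] at hx
    rcases hx with hx | hx
    · exact hC hx.1
    · exact hD hx.1
  have hDC3 : ∀ w ∉ B, Odd (G.neighborFinset w ∩ symmDiff C D).card := by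
    intro w hw
    have : G.neighborFinset w ∩ symmDiff C D
        = symmDiff (G.neighborFinset w ∩ C) (G.neighborFinset w ∩ D) := by
      ext x; simp only [Finset.mem_inter, Finset.mem_symmDiff]; tauto
    rw [this, odd_card_symmDiff]
    have := hD3 w hw
    have := hC3 w hw
    tauto
  have hDC4 := odd_card_symmDiff C D
  by_cases hq : q
  · by_cases hp : (Odd C.card ↔ p)
    · exact ⟨C, hC, hp, fun w hw => by simp [hq, hC3 w hw]⟩
    · exact ⟨symmDiff C D, hDC, by tauto, fun w hw => by
        have := hDC3 w hw; tauto⟩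
  · by_cases hp : p
    · exact ⟨D, hD, by tauto, fun w hw => by have := hD3 w hw; tauto⟩
    · exact ⟨∅, by simp, by simp [hp], fun w hw => by simp [hq]⟩

/-- The vertex set with prescribed fibers. -/
def glue {V1 V2 : Type*} [Fintype V1] [Fintype V2] [DecidableEq V2]
    (X : V1 → Finset V2) : Finset (V1 × V2) :=
  Finset.univ.filter fun x => x.2 ∈ X x.1

theorem card_fibers {V1 V2 : Type*} [Fintype V1] [Fintype V2] [DecidableEq V1] [DecidableEq V2]
    (A : Finset (V1 × V2)) :
    A.card = ∑ v : V1, (Finset.univ.filter fun w => (v, w) ∈ A).card := by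
  simp only [Finset.card_filter]
  rw [← Fintype.sum_prod_type (fun x : V1 × V2 => if (x.1, x.2) ∈ A then 1 else 0)]
  simp

theorem odd_sum_cards {V1 V2 : Type*} [DecidableEq V1]
    (X : V1 → Finset V2) (T s : Finset V1) (hT : ∀ v, Odd (X v).card ↔ v ∈ T) :
    Odd (∑ v ∈ s, (X v).card) ↔ Odd (s ∩ T).card := by
  rw [Finset.odd_sum_iff_odd_card_odd]
  have : s.filter (fun v => Odd (X v).card) = s ∩ T := by
    ext v; simp [hT]
  rw [this]

theorem odd_card_glue {V1 V2 : Type*} [Fintype V1] [Fintype V2] [DecidableEq V1] [DecidableEq V2]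
    (X : V1 → Finset V2) (T : Finset V1) (hT : ∀ v, Odd (X v).card ↔ v ∈ T) :
    Odd (glue X).card ↔ Odd T.card := by
  have := odd_sum_cards X T Finset.univ hT
  rw [Finset.univ_inter] at this
  rw [← this, card_fibers]
  simp [glue]

theorem lexProd_adj_iff {V1 V2 : Type*} (G1 : SimpleGraph V1) (G2 : SimpleGraph V2)
    (a b : V1 × V2) :
    (lexProd G1 G2).Adj a b ↔ G1.Adj a.1 b.1 ∨ (a.1 = b.1 ∧ G2.Adj a.2 b.2) := Iff.rfl

theorem odd_nbr_glue {V1 V2 : Type*} [Fintype V1] [Fintype V2]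
    [DecidableEq V1] [DecidableEq V2]
    (G1 : SimpleGraph V1) (G2 : SimpleGraph V2)
    [DecidableRel G1.Adj] [DecidableRel G2.Adj]
    (X : V1 → Finset V2) (T : Finset V1) (hT : ∀ v, Odd (X v).card ↔ v ∈ T) (u : V1) (w : V2) :
    (u, w) ∈ oddNbhd (lexProd G1 G2) (glue X) ↔
      ¬ (Odd (G1.neighborFinset u ∩ T).card ↔ Odd (G2.neighborFinset w ∩ X u).card) := by
  have key : ((lexProd G1 G2).neighborFinset (u, w) ∩ glue X).card
      = (∑ v ∈ G1.neighborFinset u, (X v).card) + (G2.neighborFinset w ∩ X u).card := by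
    rw [card_fibers]
    have h : ∀ v : V1, (Finset.univ.filter fun x =>
        (v, x) ∈ (lexProd G1 G2).neighborFinset (u, w) ∩ glue X).card
        = (if v ∈ G1.neighborFinset u then (X v).card else 0)
          + (if v = u then (G2.neighborFinset w ∩ X u).card else 0) := by
      intro v
      by_cases hv : v = u
      · subst hv
        simp only [SimpleGraph.mem_neighborFinset, SimpleGraph.irrefl, if_false, if_true, zero_add]
        congr 1
        ext x
        simp [glue, lexProd_adj_iff]
      · have hv2 : u ≠ v := fun h => hv h.symm
        by_cases ha : G1.Adj u v
        · simp only [SimpleGraph.mem_neighborFinset, ha, hv, if_false, if_true, add_zero]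
          congr 1
          ext x
          simp [glue, lexProd_adj_iff, ha]
        · simp [glue, lexProd_adj_iff, ha, hv, hv2]
    rw [Finset.sum_congr rfl (fun v _ => h v), Finset.sum_add_distrib, Finset.sum_ite_mem,
      Finset.univ_inter]
    simp
  have h2 := odd_sum_cards X T (G1.neighborFinset u) hT
  simp only [oddNbhd, Finset.mem_filter, Finset.mem_univ, true_and]
  rw [key, ← h2]
  simp only [Nat.odd_iff]
  omega

/-- If `G1` realizes a `((k1,n1))` qQSS* access structure and `G2` realizes a
`((k2,n2))` one, then `G1 * G2` realizes a `((k, n1·n2))` qQSS* access structure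
with `k = n1·n2 − (n1−k1+1)(n2−k2+1) + 1`. -/
theorem lexProd_realizesQQSS {V1 V2 : Type*} [Fintype V1] [Fintype V2]
    [DecidableEq V1] [DecidableEq V2]
    (G1 : SimpleGraph V1) (G2 : SimpleGraph V2)
    [DecidableRel G1.Adj] [DecidableRel G2.Adj]
    (n1 n2 k1 k2 : ℕ) (hn1 : Fintype.card V1 = n1) (hn2 : Fintype.card V2 = n2)
    (hk1 : 1 ≤ k1) (hk1n : k1 ≤ n1) (hk2 : 1 ≤ k2) (hk2n : k2 ≤ n2)
    (h1 : realizesQQSS G1 k1) (h2 : realizesQQSS G2 k2) :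
    realizesQQSS (lexProd G1 G2)
      (n1 * n2 - (n1 - k1 + 1) * (n2 - k2 + 1) + 1) := by
  intro B hB
  classical
  let F : V1 → Finset V2 := fun v => Finset.univ.filter fun w => (v, w) ∈ B
  have memF : ∀ v w, w ∈ F v ↔ (v, w) ∈ B := by intro v w; simp [F]
  let S : Finset V1 := Finset.univ.filter fun v => k2 ≤ (F v).card
  have hS : k1 ≤ S.card := by
    by_contra hlt
    have e1 : Bᶜ.card = ∑ v, (F v)ᶜ.card := by
      rw [card_fibers]
      refine Finset.sum_congr rfl fun v _ => ?_
      congr 1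
      ext w
      simp [F]
    have e2 : Sᶜ.card * (n2 - k2 + 1) ≤ ∑ v ∈ Sᶜ, (F v)ᶜ.card := by
      rw [← smul_eq_mul]
      refine Finset.card_nsmul_le_sum _ _ _ fun v hv => ?_
      have hv' : (F v).card < k2 := by simpa [S] using hv
      rw [Finset.card_compl, hn2]
      omega
    have e3 : ∑ v ∈ Sᶜ, (F v)ᶜ.card ≤ ∑ v, (F v)ᶜ.card :=
      Finset.sum_le_sum_of_subset (Finset.subset_univ _)
    have e4 : n1 - k1 + 1 ≤ Sᶜ.card := by
      rw [Finset.card_compl, hn1]; omega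
    have e5 : (n1 - k1 + 1) * (n2 - k2 + 1) ≤ Sᶜ.card * (n2 - k2 + 1) :=
      Nat.mul_le_mul_right _ e4
    have e6 : Bᶜ.card = n1 * n2 - B.card := by
      rw [Finset.card_compl, Fintype.card_prod, hn1, hn2]
    have e7 : (n1 - k1 + 1) * (n2 - k2 + 1) ≤ n1 * n2 :=
      Nat.mul_le_mul (by omega) (by omega)
    have e8 : 0 < (n1 - k1 + 1) * (n2 - k2 + 1) := by positivity
    generalize (n1 - k1 + 1) * (n2 - k2 + 1) = m at *
    omega
  have sa1 : stronglyAccessing G1 S := sa_of_le G1 h1 hS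
  have sa2 : ∀ v ∈ S, stronglyAccessing G2 (F v) := fun v hv =>
    sa_of_le G2 h2 (by simpa [S] using hv)
  have build : ∀ (T : Finset V1) (Q : V1 → Prop), T ⊆ S → ∃ X : V1 → Finset V2,
      (∀ v, X v ⊆ F v) ∧ (∀ v, Odd (X v).card ↔ v ∈ T) ∧ (∀ v ∉ S, X v = ∅) ∧
      ∀ v ∈ S, ∀ w ∉ F v, (Odd (G2.neighborFinset w ∩ X v).card ↔ Q v) := by
    intro T Q hT
    have : ∀ v, ∃ Y : Finset V2, Y ⊆ F v ∧ (Odd Y.card ↔ v ∈ T) ∧ (v ∉ S → Y = ∅) ∧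
        (v ∈ S → ∀ w ∉ F v, (Odd (G2.neighborFinset w ∩ Y).card ↔ Q v)) := by
      intro v
      by_cases hv : v ∈ S
      · obtain ⟨Y, a, b, c⟩ := sa_choose G2 (sa2 v hv) (v ∈ T) (Q v)
        exact ⟨Y, a, b, fun h => absurd hv h, fun _ => c⟩
      · have : v ∉ T := fun h => hv (hT h)
        exact ⟨∅, by simp, by simp [this], fun _ => rfl, fun h => absurd h hv⟩
    choose X a b c d using this
    exact ⟨X, a, b, c, d⟩
  have glue_sub : ∀ X : V1 → Finset V2, (∀ v, X v ⊆ F v) → glue X ⊆ B := by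
    rintro X hX ⟨v, w⟩ hx
    exact (memF v w).1 (hX v (by simpa [glue] using hx))
  obtain ⟨⟨D, hD, ho, hD2⟩, C, hC, hC2⟩ := sa1
  constructor
  · obtain ⟨X, a, b, c, d⟩ := build D (fun v => Odd (G1.neighborFinset v ∩ D).card) hD
    refine ⟨glue X, glue_sub X a, (odd_card_glue X D b).2 ho, ?_⟩
    rintro ⟨u, w⟩ hx
    rw [odd_nbr_glue G1 G2 X D b] at hx
    by_contra hB'
    rw [← memF] at hB'
    by_cases hu : u ∈ S
    · exact hx (d u hu w hB').symm
    · have h3 : ¬ Odd (G1.neighborFinset u ∩ D).card := fun h =>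
        hu (hD2 (by simpa [oddNbhd] using h))
      rw [c u hu] at hx
      simp [h3] at hx
  · obtain ⟨X, a, b, c, d⟩ := build C (fun v => ¬ Odd (G1.neighborFinset v ∩ C).card) hC
    refine ⟨glue X, glue_sub X a, ?_⟩
    rintro ⟨u, w⟩ hx
    rw [Finset.mem_compl, ← memF] at hx
    rw [odd_nbr_glue G1 G2 X C b]
    by_cases hu : u ∈ S
    · have := d u hu w hx
      tauto
    · have h3 : Odd (G1.neighborFinset u ∩ C).card := by
        simpa [oddNbhd] using hC2 (Finset.mem_compl.mpr hu)
      rw [c u hu]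
      simp [h3]
end

section
/- Let G be a finite simple graph on n vertices realizing a ((k,n)) qQSS* access structure. Then for every integer i ≥ 1 the i-fold lexicographic power G^{*i} = G * G * ⋯ * G (i factors) realizes a ((k_i, n_i)) qQSS* access structure, where n_i = n^i and k_i = n^i − (n−k+1)^i + 1. -/
open Finset

/-- The `i`-fold lexicographic power of `G`, on vertex set `Fin i → V`:
two tuples are adjacent iff at some coordinate `j` they are adjacent in `G`
while agreeing on all earlier coordinates.  This is the `i`-fold iteration
of the lexicographic product `G * G * ⋯ * G`. -/
def lexPow {V : Type*} (G : SimpleGraph V) (i : ℕ) : SimpleGraph (Fin i → V) where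
  Adj x y := ∃ j : Fin i, (∀ l, l < j → x l = y l) ∧ G.Adj (x j) (y j)
  symm := by
    refine ⟨?_⟩
    rintro x y ⟨j, hpre, hadj⟩
    exact ⟨j, fun l hl => (hpre l hl).symm, hadj.symm⟩
  loopless := by
    refine ⟨?_⟩
    rintro x ⟨j, _, hadj⟩
    exact G.loopless.irrefl _ hadj

instance {V : Type*} [DecidableEq V] (G : SimpleGraph V) [DecidableRel G.Adj] (i : ℕ) :
    DecidableRel (lexPow G i).Adj := fun x y =>
  inferInstanceAs (Decidable (∃ j : Fin i, (∀ l, l < j → x l = y l) ∧ G.Adj (x j) (y j)))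

/-- Linear-algebraic form of strong access, for the complement `E` of the player set. -/
def SolvesAll {V : Type*} [Fintype V] (G : SimpleGraph V) [DecidableRel G.Adj]
    (E : Finset V) : Prop :=
  ∀ a b : ZMod 2, ∃ f : V → ZMod 2, (∀ v ∈ E, f v = 0) ∧ ∑ v, f v = a ∧
    ∀ v ∈ E, ∑ w, (if G.Adj v w then f w else 0) = b

lemma SolvesAll.mono {V : Type*} [Fintype V] {G : SimpleGraph V} [DecidableRel G.Adj]
    {E E' : Finset V} (hE : E ⊆ E') (h : SolvesAll G E') : SolvesAll G E := by
  intro a b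
  obtain ⟨f, h1, h2, h3⟩ := h a b
  exact ⟨f, fun v hv => h1 v (hE hv), h2, fun v hv => h3 v (hE hv)⟩

lemma sum_ind {V : Type*} [Fintype V] [DecidableEq V] (D : Finset V) :
    ∑ v, (if v ∈ D then (1 : ZMod 2) else 0) = (D.card : ZMod 2) := by
  simp

lemma sum_adj_ind {V : Type*} [Fintype V] [DecidableEq V] (G : SimpleGraph V)
    [DecidableRel G.Adj] (D : Finset V) (v : V) :
    ∑ w, (if G.Adj v w then (if w ∈ D then (1 : ZMod 2) else 0) else 0)
      = ((G.neighborFinset v ∩ D).card : ZMod 2) := by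
  rw [← sum_ind]
  refine Finset.sum_congr rfl fun w _ => ?_
  by_cases h1 : G.Adj v w <;> by_cases h2 : w ∈ D <;> simp [h1, h2]

lemma solvesAll_of_strong {V : Type*} [Fintype V] [DecidableEq V] (G : SimpleGraph V)
    [DecidableRel G.Adj] (B : Finset V) (h : stronglyAccessing G B) : SolvesAll G Bᶜ := by
  obtain ⟨⟨D, hDB, hodd, hD⟩, C, hCB, hC⟩ := h
  intro a b
  have hD1 : (D.card : ZMod 2) = 1 := (ZMod.natCast_eq_one_iff_odd).2 hodd
  refine ⟨fun v => b * (if v ∈ C then 1 else 0)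
    + (a + b * (C.card : ZMod 2)) * (if v ∈ D then 1 else 0), ?_, ?_, ?_⟩
  · intro v hv
    rw [Finset.mem_compl] at hv
    have h1 : v ∉ C := fun h => hv (hCB h)
    have h2 : v ∉ D := fun h => hv (hDB h)
    simp [h1, h2]
  · rw [Finset.sum_add_distrib, ← Finset.mul_sum, ← Finset.mul_sum, sum_ind, sum_ind, hD1]
    have : b * (C.card : ZMod 2) + b * (C.card : ZMod 2) = 0 := CharTwo.add_self_eq_zero _
    linear_combination this
  · intro v hv
    have e1 : ((G.neighborFinset v ∩ C).card : ZMod 2) = 1 := by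
      have := hC hv
      simp only [oddNbhd, Finset.mem_filter] at this
      exact (ZMod.natCast_eq_one_iff_odd).2 this.2
    have e2 : ((G.neighborFinset v ∩ D).card : ZMod 2) = 0 := by
      have : v ∉ oddNbhd G D := fun h => (Finset.mem_compl.1 hv) (hD h)
      simp only [oddNbhd, Finset.mem_filter, Finset.mem_univ, true_and,
        Nat.not_odd_iff_even] at this
      exact (ZMod.natCast_eq_zero_iff_even).2 this
    have : ∀ w, (if G.Adj v w then b * (if w ∈ C then 1 else 0)
        + (a + b * (C.card : ZMod 2)) * (if w ∈ D then 1 else 0) else 0)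
        = b * (if G.Adj v w then (if w ∈ C then (1 : ZMod 2) else 0) else 0)
        + (a + b * (C.card : ZMod 2)) *
          (if G.Adj v w then (if w ∈ D then (1 : ZMod 2) else 0) else 0) := by
      intro w
      by_cases h1 : G.Adj v w <;> simp [h1]
    rw [Finset.sum_congr rfl fun w _ => this w, Finset.sum_add_distrib, ← Finset.mul_sum,
      ← Finset.mul_sum, sum_adj_ind, sum_adj_ind, e1, e2]
    ring

lemma exists_set {V : Type*} [Fintype V] [DecidableEq V] (f : V → ZMod 2) :
    ∃ D : Finset V, ∀ v, f v = if v ∈ D then 1 else 0 := by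
  refine ⟨Finset.univ.filter fun v => f v = 1, fun v => ?_⟩
  have : ∀ x : ZMod 2, x = if x = 1 then 1 else 0 := by decide
  simpa using this (f v)

lemma strong_of_solvesAll {V : Type*} [Fintype V] [DecidableEq V] (G : SimpleGraph V)
    [DecidableRel G.Adj] (B : Finset V) (h : SolvesAll G Bᶜ) : stronglyAccessing G B := by
  have key : ∀ a b : ZMod 2, ∃ D ⊆ B, (D.card : ZMod 2) = a ∧
      ∀ v ∉ B, ((G.neighborFinset v ∩ D).card : ZMod 2) = b := by
    intro a b
    obtain ⟨f, h1, h2, h3⟩ := h a b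
    obtain ⟨D, hD⟩ := exists_set f
    obtain rfl : f = fun v => if v ∈ D then 1 else 0 := funext hD
    refine ⟨D, ?_, ?_, ?_⟩
    · intro v hv
      by_contra hB
      have := h1 v (Finset.mem_compl.2 hB)
      simp [hv] at this
    · rw [← sum_ind, h2]
    · intro v hv
      rw [← sum_adj_ind, h3 v (Finset.mem_compl.2 hv)]
  constructor
  · obtain ⟨D, hDB, h1, h2⟩ := key 1 0
    refine ⟨D, hDB, (ZMod.natCast_eq_one_iff_odd).1 h1, fun v hv => ?_⟩
    by_contra hB
    have h3 := (ZMod.natCast_eq_zero_iff_even).1 (h2 v hB)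
    simp only [oddNbhd, Finset.mem_filter, Finset.mem_univ, true_and] at hv
    exact Nat.not_odd_iff_even.2 h3 hv
  · obtain ⟨C, hCB, -, h2⟩ := key 0 1
    refine ⟨C, hCB, fun v hv => ?_⟩
    simp only [oddNbhd, Finset.mem_filter, Finset.mem_univ, true_and]
    exact (ZMod.natCast_eq_one_iff_odd).1 (h2 v (Finset.mem_compl.1 hv))

lemma lexPow_adj_cons {V : Type*} (G : SimpleGraph V) (i : ℕ) (u u' : V) (x y : Fin i → V) :
    (lexPow G (i + 1)).Adj (Fin.cons u x) (Fin.cons u' y) ↔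
      G.Adj u u' ∨ (u = u' ∧ (lexPow G i).Adj x y) := by
  simp only [lexPow]
  constructor
  · rintro ⟨j, h1, h2⟩
    induction j using Fin.cases with
    | zero => left; simpa using h2
    | succ j =>
      right
      refine ⟨by simpa using h1 0 (Fin.succ_pos j), j, fun l hl => ?_, by simpa using h2⟩
      simpa using h1 l.succ (Fin.succ_lt_succ_iff.2 hl)
  · rintro (h | ⟨rfl, j, h1, h2⟩)
    · exact ⟨0, fun l hl => absurd hl (Fin.not_lt_zero l), by simpa using h⟩
    · refine ⟨j.succ, fun l hl => ?_, by simpa using h2⟩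
      induction l using Fin.cases with
      | zero => simp
      | succ l => simpa using h1 l (Fin.succ_lt_succ_iff.1 hl)

lemma sum_lex_cons {V : Type*} [Fintype V] [DecidableEq V] (i : ℕ)
    (g : (Fin (i + 1) → V) → ZMod 2) :
    ∑ x, g x = ∑ u, ∑ y : Fin i → V, g (Fin.cons u y) := by
  rw [← Fintype.sum_prod_type']
  exact (Fintype.sum_equiv (Fin.consEquiv fun _ => V) _ _ (fun _ => rfl)).symm

lemma solvesAll_pow {V : Type*} [Fintype V] [DecidableEq V] (G : SimpleGraph V)
    [DecidableRel G.Adj] (m : ℕ) (h : ∀ E : Finset V, E.card < m → SolvesAll G E) (i : ℕ) :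
    ∀ E : Finset (Fin i → V), E.card < m ^ i → SolvesAll (lexPow G i) E := by
  induction i with
  | zero =>
    intro E hE a b
    have : E = ∅ := by simpa using hE
    subst this
    exact ⟨fun _ => a, by simp, by simp, by simp⟩
  | succ i ih =>
    intro E hE a b
    let F : V → Finset (Fin i → V) := fun u => Finset.univ.filter fun y => Fin.cons u y ∈ E
    let Z : Finset V := Finset.univ.filter fun u => m ^ i ≤ (F u).card
    have hsum : ∑ u, (F u).card = E.card := by
      have e : E.card = ∑ x : Fin (i + 1) → V, if x ∈ E then 1 else 0 := by simp
      rw [e, ← Fintype.sum_equiv (Fin.consEquiv fun _ => V)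
        (fun p => if (Fin.cons p.1 p.2 : Fin (i + 1) → V) ∈ E then 1 else 0) _ (fun _ => rfl),
        Fintype.sum_prod_type]
      simp [F]
    have hZ : Z.card < m := by
      have h1 : Z.card * m ^ i ≤ ∑ u ∈ Z, (F u).card := by
        rw [← smul_eq_mul]
        exact Finset.card_nsmul_le_sum _ _ _ fun u hu => (Finset.mem_filter.1 hu).2
      have h2 : ∑ u ∈ Z, (F u).card ≤ ∑ u, (F u).card :=
        Finset.sum_le_sum_of_subset (Finset.subset_univ _)
      have h3 : Z.card * m ^ i < m * m ^ i := by
        rw [pow_succ'] at hE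
        omega
      exact lt_of_mul_lt_mul_right h3 (Nat.zero_le _)
    obtain ⟨f, f1, f2, f3⟩ := h Z hZ a b
    have hfib : ∀ u, ∃ g : (Fin i → V) → ZMod 2, (∀ y ∈ F u, g y = 0) ∧ ∑ y, g y = f u ∧
        ∀ y ∈ F u, (∑ w, if G.Adj u w then f w else 0)
          + ∑ z, (if (lexPow G i).Adj y z then g z else 0) = b := by
      intro u
      by_cases hu : u ∈ Z
      · refine ⟨fun _ => 0, by simp, by simp [f1 u hu], fun y _ => ?_⟩
        simp [f3 u hu]
      · have hc : (F u).card < m ^ i := by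
          by_contra hc
          exact hu (Finset.mem_filter.2 ⟨Finset.mem_univ _, not_lt.1 hc⟩)
        obtain ⟨g, g1, g2, g3⟩ := ih (F u) hc (f u)
          (b - ∑ w, if G.Adj u w then f w else 0)
        refine ⟨g, g1, g2, fun y hy => ?_⟩
        rw [g3 y hy]
        ring
    choose g g1 g2 g3 using hfib
    refine ⟨fun x => g (x 0) (Fin.tail x), ?_, ?_, ?_⟩
    · intro x hx
      refine g1 _ _ (Finset.mem_filter.2 ⟨Finset.mem_univ _, ?_⟩)
      rwa [Fin.cons_self_tail]
    · rw [sum_lex_cons, ← f2]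
      refine Finset.sum_congr rfl fun u _ => ?_
      rw [← g2 u]
      simp
    · intro x hx
      obtain ⟨u, y, rfl⟩ : ∃ u y, x = Fin.cons u y := ⟨x 0, Fin.tail x, by simp⟩
      rw [← g3 u y (Finset.mem_filter.2 ⟨Finset.mem_univ _, hx⟩), sum_lex_cons]
      have e : ∑ z, (if (lexPow G i).Adj y z then g u z else 0)
          = ∑ w, if u = w then ∑ z, (if (lexPow G i).Adj y z then g w z else 0) else 0 := by
        simp
      rw [e, ← Finset.sum_add_distrib]
      refine Finset.sum_congr rfl fun w _ => ?_
      simp only [lexPow_adj_cons, Fin.cons_zero, Fin.tail_cons]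
      by_cases h1 : G.Adj u w
      · have h2 : u ≠ w := h1.ne
        simp [h1, h2, g2]
      · by_cases h2 : u = w <;> simp [h1, h2]

/-- If `G` (on `n` vertices) realizes a `((k,n))` qQSS* access structure, then for every
`i ≥ 1` the `i`-fold lexicographic power `G^{*i}` realizes a `((kᵢ, nᵢ))` qQSS* access
structure with `nᵢ = nⁱ` and `kᵢ = nⁱ − (n−k+1)ⁱ + 1`. -/
theorem lexPow_realizesQQSS {V : Type*} [Fintype V] [DecidableEq V]
    (G : SimpleGraph V) [DecidableRel G.Adj]
    (n k : ℕ) (hn : Fintype.card V = n) (hk1 : 1 ≤ k) (hkn : k ≤ n)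
    (h : realizesQQSS G k) :
    ∀ i : ℕ, 1 ≤ i → realizesQQSS (lexPow G i) (n ^ i - (n - k + 1) ^ i + 1) := by
  intro i _ B hB
  have hm : (n - k + 1) ^ i ≤ n ^ i := Nat.pow_le_pow_left (by omega) i
  have hpos : 0 < (n - k + 1) ^ i := Nat.pow_pos (by omega)
  apply strong_of_solvesAll
  apply solvesAll_pow G (n - k + 1)
  · intro E hE
    have hc : k ≤ Eᶜ.card := by
      rw [Finset.card_compl, hn]
      omega
    obtain ⟨B', hB', hcard⟩ := Finset.exists_subset_card_eq hc
    refine (solvesAll_of_strong G B' (h B' hcard)).mono ?_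
    intro v hv
    rw [Finset.mem_compl]
    intro hv'
    exact Finset.mem_compl.1 (hB' hv') hv
  · have : Fintype.card (Fin i → V) = n ^ i := by simp [hn]
    rw [Finset.card_compl, this, hB]
    omega
end
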